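/- Let n be a positive integer with n ∣ v_n, and let p be an odd prime. Then np ∣ v_{np} if and only if p divides v_n. -/

import Mathlib

/-- Lucas sequence of the second kind: `v 0 = 2`, `v 1 = P`,
`v (n+2) = P * v (n+1) - Q * v n`. -/
def lucasV (P Q : ℤ) : ℕ → ℤ
  | 0 => 2
  | 1 => P
  | n + 2 => P * lucasV P Q (n + 1) - Q * lucasV P Q n

/-- Binet's formula in any commutative ring. -/
theorem lucasV_cast_eq_pow_add_pow {R : Type*} [CommRing R] {P Q : ℤ} {α β : R}
    (hP : (P : R) = α + β) (hQ : (Q : R) = α * β) (n : ℕ) :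
    (lucasV P Q n : R) = α ^ n + β ^ n := by
  induction n using Nat.twoStepInduction with
  | zero => norm_num [lucasV]
  | one => simp [lucasV, hP]
  | more n ih₁ ih₂ =>
    simp only [lucasV, Int.cast_sub, Int.cast_mul, ih₁, ih₂, hP, hQ]
    ring

theorem exists_add_eq_and_mul_eq {K : Type*} [Field K] [IsAlgClosed K] (s t : K) :
    ∃ α β : K, s = α + β ∧ t = α * β := by
  have hdeg : (Polynomial.X ^ 2 - Polynomial.C s * Polynomial.X + Polynomial.C t).degree = 2 := by
    compute_degree!
  obtain ⟨α, hα⟩ := IsAlgClosed.exists_root _ (by rw [hdeg]; decide)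
  refine ⟨α, s - α, by ring, ?_⟩
  simp only [Polynomial.IsRoot.def, Polynomial.eval_add, Polynomial.eval_sub, Polynomial.eval_pow,
    Polynomial.eval_mul, Polynomial.eval_X, Polynomial.eval_C] at hα
  linear_combination hα

theorem lucasV_add_two_mul (P Q : ℤ) (n k : ℕ) :
    lucasV P Q (k + 2 * n) = lucasV P Q n * lucasV P Q (k + n) - Q ^ n * lucasV P Q k := by
  obtain ⟨α, β, hP, hQ⟩ := exists_add_eq_and_mul_eq (P : ℂ) (Q : ℂ)
  apply Int.cast_injective (α := ℂ)
  push_cast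
  simp only [lucasV_cast_eq_pow_add_pow hP hQ, hQ]
  ring

theorem prime_dvd_lucasV_mul_iff (P Q : ℤ) (n : ℕ) {p : ℕ} (hp : p.Prime) :
    (p : ℤ) ∣ lucasV P Q (n * p) ↔ (p : ℤ) ∣ lucasV P Q n := by
  have := Fact.mk hp
  let K := AlgebraicClosure (ZMod p)
  have : CharP K p := charP_of_injective_algebraMap (algebraMap (ZMod p) K).injective p
  obtain ⟨α, β, hP, hQ⟩ := exists_add_eq_and_mul_eq (P : K) (Q : K)
  have h : (lucasV P Q (n * p) : K) = (lucasV P Q n : K) ^ p := by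
    simp only [lucasV_cast_eq_pow_add_pow hP hQ, add_pow_char, pow_mul]
  rw [← CharP.intCast_eq_zero_iff K p, ← CharP.intCast_eq_zero_iff K p, h,
    pow_eq_zero_iff hp.ne_zero]

theorem sq_lucasV_dvd_sub (P Q : ℤ) (n m : ℕ) :
    lucasV P Q n ^ 2 ∣ lucasV P Q (n * (2 * m)) - 2 * (-Q ^ n) ^ m ∧
    lucasV P Q n ^ 2 ∣
      lucasV P Q (n * (2 * m + 1)) - (2 * m + 1) * (-Q ^ n) ^ m * lucasV P Q n := by
  induction m with
  | zero => simp [lucasV]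
  | succ m ih =>
    obtain ⟨⟨c, hc⟩, ⟨d, hd⟩⟩ := ih
    have h₁ := lucasV_add_two_mul P Q n (n * (2 * m))
    have h₂ := lucasV_add_two_mul P Q n (n * (2 * m + 1))
    rw [show n * (2 * m) + 2 * n = n * (2 * (m + 1)) by ring,
      show n * (2 * m) + n = n * (2 * m + 1) by ring] at h₁
    rw [show n * (2 * m + 1) + 2 * n = n * (2 * (m + 1) + 1) by ring,
      show n * (2 * m + 1) + n = n * (2 * (m + 1)) by ring] at h₂
    set x := lucasV P Q n
    have he : lucasV P Q (n * (2 * (m + 1))) - 2 * (-Q ^ n) ^ (m + 1) =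
        x ^ 2 * ((2 * m + 1) * (-Q ^ n) ^ m + x * d - Q ^ n * c) := by
      linear_combination h₁ + x * hd - Q ^ n * hc
    refine ⟨⟨_, he⟩, x * ((2 * m + 1) * (-Q ^ n) ^ m + x * d - Q ^ n * c) - Q ^ n * d, ?_⟩
    push_cast
    linear_combination h₂ + x * he - Q ^ n * hd

/-- For `n ∈ T` and `p` an odd prime, `np ∈ T` iff `p ∣ v_n`. -/
theorem lucasV_mul_odd_prime_mem_T_iff (P Q : ℤ) (n : ℕ) (hn : 0 < n)
    (hnT : (n : ℤ) ∣ lucasV P Q n) (p : ℕ) (hp : p.Prime) (hp2 : p ≠ 2) :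
    ((n * p : ℕ) : ℤ) ∣ lucasV P Q (n * p) ↔ (p : ℤ) ∣ lucasV P Q n := by
  rw [← prime_dvd_lucasV_mul_iff P Q n hp]
  refine ⟨fun h => (Int.natCast_dvd_natCast.mpr (dvd_mul_left p n)).trans h, fun h => ?_⟩
  rw [prime_dvd_lucasV_mul_iff P Q n hp] at h
  obtain ⟨m, hm⟩ := hp.odd_of_ne_two hp2
  have hsq := (sq_lucasV_dvd_sub P Q n m).2
  have hpm : (2 * m + 1 : ℤ) = p := by exact_mod_cast hm.symm
  rw [← hm, hpm] at hsq
  push_cast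
  rw [← dvd_sub_left (c := (p : ℤ) * (-Q ^ n) ^ m * lucasV P Q n)]
  · exact (mul_dvd_mul hnT h).trans (by rwa [← sq])
  · rw [mul_comm, mul_assoc]
    exact mul_dvd_mul_left _ (hnT.mul_left _)
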